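/- The dimension of the affine hull of Ptt(n) is exactly 3n³ − 8n² + 6n. -/

import Mathlib

open Finset

attribute [local instance] Classical.propDecidable

namespace TTP

/-- `(k,i,j)` is a valid match index: slot `k ∈ S = {1,…,2n-2}`, home venue `i` and
away team `j` are distinct elements of `V = {1,…,n}`. -/
def IsMatch (n : ℕ) (m : ℕ × ℕ × ℕ) : Prop :=
  1 ≤ m.1 ∧ m.1 ≤ 2 * n - 2 ∧ 1 ≤ m.2.1 ∧ m.2.1 ≤ n ∧ 1 ≤ m.2.2 ∧ m.2.2 ≤ n ∧ m.2.1 ≠ m.2.2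

/-- `(t,i,j)` is a valid travel index: `t ∈ V` and `(i,j) ∈ A`. -/
def IsTravelIdx (n : ℕ) (p : ℕ × ℕ × ℕ) : Prop :=
  1 ≤ p.1 ∧ p.1 ≤ n ∧ 1 ≤ p.2.1 ∧ p.2.1 ≤ n ∧ 1 ≤ p.2.2 ∧ p.2.2 ≤ n ∧ p.2.1 ≠ p.2.2

/-- A (double round-robin) tournament: a set of matches such that in every slot every team
plays exactly once, and every ordered pair of distinct teams meets exactly once. -/
structure IsTournament (n : ℕ) (T : Set (ℕ × ℕ × ℕ)) : Prop where
  subset : ∀ m ∈ T, IsMatch n m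
  slot_team : ∀ k, 1 ≤ k → k ≤ 2 * n - 2 → ∀ t, 1 ≤ t → t ≤ n →
      ∃! m : ℕ × ℕ × ℕ, m ∈ T ∧ m.1 = k ∧ (t = m.2.1 ∨ t = m.2.2)
  pair : ∀ i j, 1 ≤ i → i ≤ n → 1 ≤ j → j ≤ n → i ≠ j → ∃! k : ℕ, (k, i, j) ∈ T

/-- The venue of team `t` in slot `k`: the home venue of the (unique) match of `t` in
slot `k`, and `t` itself if `t` has no match in slot `k` (in particular in the artificial
slots `0` and `2n-1`). -/
noncomputable def venue (T : Set (ℕ × ℕ × ℕ)) (t k : ℕ) : ℕ :=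
  if h : ∃ i, ∃ j, (k, i, j) ∈ T ∧ (t = i ∨ t = j) then h.choose else t

/-- The travel vector `ψ(T)`: `travel n T (t,i,j) = 1` iff for some `0 ≤ k ≤ 2n-2` team `t`
has venue `i` in slot `k` and venue `j` in slot `k+1`. -/
noncomputable def travel (n : ℕ) (T : Set (ℕ × ℕ × ℕ)) (p : ℕ × ℕ × ℕ) : ℝ :=
  if ∃ k, k ≤ 2 * n - 2 ∧ venue T p.1 k = p.2.1 ∧ venue T p.1 (k + 1) = p.2.2 then 1 else 0

/-- The play vector `χ(T)`: characteristic vector of `T`. -/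
noncomputable def play (T : Set (ℕ × ℕ × ℕ)) (m : ℕ × ℕ × ℕ) : ℝ :=
  if m ∈ T then 1 else 0

/-- The ambient space `ℝ^M × ℝ^{V×A}`. -/
abbrev Pt (n : ℕ) :=
  ({m : ℕ × ℕ × ℕ // IsMatch n m} → ℝ) × ({p : ℕ × ℕ × ℕ // IsTravelIdx n p} → ℝ)

/-- The play coordinate `x_{k,i,j}` of a point (0 at invalid indices). -/
noncomputable def xval {n : ℕ} (z : Pt n) (k i j : ℕ) : ℝ :=
  if h : IsMatch n (k, i, j) then z.1 ⟨(k, i, j), h⟩ else 0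

/-- The travel coordinate `y_{t,i,j}` of a point (0 at invalid indices). -/
noncomputable def yval {n : ℕ} (z : Pt n) (t i j : ℕ) : ℝ :=
  if h : IsTravelIdx n (t, i, j) then z.2 ⟨(t, i, j), h⟩ else 0

/-- The unconstrained traveling tournament polytope `Ptt(n)`:
the convex hull of all pairs `(χ(T), y)` with `T` a tournament and `y ∈ {0,1}^{V×A}`,
`y ≥ ψ(T)` componentwise. -/
def Ptt (n : ℕ) : Set (Pt n) :=
  convexHull ℝ { z : Pt n | ∃ T : Set (ℕ × ℕ × ℕ), IsTournament n T ∧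
    (∀ m : {m : ℕ × ℕ × ℕ // IsMatch n m}, z.1 m = play T m.1) ∧
    (∀ p : {p : ℕ × ℕ × ℕ // IsTravelIdx n p}, z.2 p = 0 ∨ z.2 p = 1) ∧
    (∀ p : {p : ℕ × ℕ × ℕ // IsTravelIdx n p}, travel n T p.1 ≤ z.2 p) }

/-- Dimension of the affine hull of a set. -/
noncomputable def adim {n : ℕ} (s : Set (Pt n)) : ℕ :=
  Module.finrank ℝ (affineSpan ℝ s).direction

/-- A valid inequality `f z ≤ γ` is facet-defining for `Ptt(n)`:
it holds on `Ptt(n)` and its face has dimension `dim Ptt(n) - 1`. -/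
def IsFacetLE {n : ℕ} (f : Pt n → ℝ) (γ : ℝ) : Prop :=
  (∀ z ∈ Ptt n, f z ≤ γ) ∧ adim {z ∈ Ptt n | f z = γ} + 1 = adim (Ptt n)

/-- A valid inequality `f z ≥ γ` is facet-defining for `Ptt(n)`:
it holds on `Ptt(n)` and its face has dimension `dim Ptt(n) - 1`. -/
def IsFacetGE {n : ℕ} (f : Pt n → ℝ) (γ : ℝ) : Prop :=
  (∀ z ∈ Ptt n, γ ≤ f z) ∧ adim {z ∈ Ptt n | f z = γ} + 1 = adim (Ptt n)


/-! ### Schedules -/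

/-- An arc is an ordered pair of distinct teams: a home team and an away team. -/
abbrev Arc (V : Type*) := {p : V × V // p.1 ≠ p.2}

/-- Team `t` takes part in the match `x`. -/
def Inc {V : Type*} (t : V) (x : Arc V) : Prop := t = x.1.1 ∨ t = x.1.2

/-- A slot assignment in which no team has two matches in the same slot. -/
def IsSched {V K : Type*} (s : Arc V → K) : Prop :=
  ∀ x y : Arc V, ∀ t, Inc t x → Inc t y → s x = s y → x = y

section Schedules

variable {V K : Type*}

theorem exists_equiv_apply_eq {ι α β : Type*} [Finite β] (e₀ : α ≃ β) {f : ι → α} {h : ι → β}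
    (hf : Function.Injective f) (hh : Function.Injective h) :
    ∃ e : α ≃ β, ∀ i, e (f i) = h i := by
  have hf' : Function.Injective (e₀ ∘ f) := e₀.injective.comp hf
  let g : {x // x ∈ Set.range (e₀ ∘ f)} ≃ {x // x ∈ Set.range h} :=
    (Equiv.ofInjective _ hf').symm.trans (Equiv.ofInjective _ hh)
  have : Fintype β := Fintype.ofFinite β
  refine ⟨e₀.trans g.extendSubtype, fun i => ?_⟩
  have h1 := g.extendSubtype_apply_of_mem (e₀ (f i)) ⟨i, rfl⟩
  rw [Equiv.trans_apply, h1]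
  simp only [g, Equiv.trans_apply, Equiv.ofInjective_apply]
  exact congrArg h (Equiv.ofInjective_symm_apply hf' i)

theorem exists_equiv_apply_two {α β : Type*} [Finite β] (e₀ : α ≃ β) {a b : α} {c d : β}
    (hab : a ≠ b) (hcd : c ≠ d) : ∃ e : α ≃ β, e a = c ∧ e b = d := by
  obtain ⟨e, he⟩ := exists_equiv_apply_eq e₀ (f := fun i : Bool => cond i a b)
    (h := fun i : Bool => cond i c d)
    (by intro i j; cases i <;> cases j <;> simp [hab, hab.symm])
    (by intro i j; cases i <;> cases j <;> simp [hcd, hcd.symm])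
  exact ⟨e, he true, he false⟩

theorem exists_equiv_apply_four {α β : Type*} [Finite β] (e₀ : α ≃ β) {a b c d : α}
    {a' b' c' d' : β} (hab : a ≠ b) (hac : a ≠ c) (had : a ≠ d) (hbc : b ≠ c) (hbd : b ≠ d)
    (hcd : c ≠ d) (hab' : a' ≠ b') (hac' : a' ≠ c') (had' : a' ≠ d') (hbc' : b' ≠ c')
    (hbd' : b' ≠ d') (hcd' : c' ≠ d') :
    ∃ e : α ≃ β, e a = a' ∧ e b = b' ∧ e c = c' ∧ e d = d' := by
  obtain ⟨e, he⟩ := exists_equiv_apply_eq e₀ (f := ![a, b, c, d]) (h := ![a', b', c', d'])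
    (by intro i j; fin_cases i <;> fin_cases j <;> simp [*, Ne.symm, eq_comm])
    (by intro i j; fin_cases i <;> fin_cases j <;> simp [*, Ne.symm, eq_comm])
  exact ⟨e, he 0, he 1, he 2, he 3⟩

/-- The edge colouring of the complete graph on `ℤ/m ∪ {∞}` given by the circle method. -/
def circleColor (m : ℕ) : Option (ZMod m) → Option (ZMod m) → ZMod m
  | none, none => 0
  | none, some a => a + a
  | some a, none => a + a
  | some a, some b => a + b

theorem circleColor_comm {m : ℕ} (u v : Option (ZMod m)) :
    circleColor m u v = circleColor m v u := by
  rcases u with _ | a <;> rcases v with _ | b <;> simp [circleColor, add_comm]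

theorem add_self_injective_of_odd {m : ℕ} (hm : Odd m) {a b : ZMod m} (h : a + a = b + b) :
    a = b := by
  obtain ⟨r, rfl⟩ := hm
  have h0 : ((2 * r + 1 : ℕ) : ZMod (2 * r + 1)) = 0 := ZMod.natCast_self _
  push_cast at h0
  linear_combination (-(r : ZMod (2 * r + 1))) * h + (a - b) * h0

theorem circleColor_injective {m : ℕ} (hm : Odd m) {u v w : Option (ZMod m)} (huv : u ≠ v)
    (huw : u ≠ w) (h : circleColor m u v = circleColor m u w) : v = w := by
  rcases u with _ | a <;> rcases v with _ | b <;> rcases w with _ | c <;>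
    simp_all [circleColor]
  exact add_self_injective_of_odd hm h

/-- Two one-factorizations, played one after the other with opposite home rights. -/
theorem isSched_of_colorings {C : Type*} {c : Bool → V → V → C} (hc : ∀ b u v, c b u v = c b v u)
    (hinj : ∀ b u v w, u ≠ v → u ≠ w → c b u v = c b u w → v = w) {r : V → ℕ}
    (hr : Function.Injective r) (g : Bool × C ≃ K) :
    IsSched fun x : Arc V =>
      g (decide (r x.1.1 < r x.1.2), c (decide (r x.1.1 < r x.1.2)) x.1.1 x.1.2) := by
  rintro ⟨⟨x, x'⟩, hx⟩ ⟨⟨y, y'⟩, hy⟩ t htx hty h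
  have h := g.injective h
  simp only [Prod.mk.injEq, decide_eq_decide] at h
  obtain ⟨h1, h2⟩ := h
  simp only [h1] at h2
  simp only [Inc] at htx hty
  simp only [ne_eq] at hx hy
  rcases htx with rfl | rfl <;> rcases hty with rfl | rfl
  · obtain rfl := hinj _ _ _ _ hx hy h2
    rfl
  · rw [hc _ y] at h2
    obtain rfl := hinj _ _ _ _ hx (Ne.symm hy) h2
    have := hr.ne hx
    omega
  · rw [hc _ x] at h2
    obtain rfl := hinj _ _ _ _ (Ne.symm hx) hy h2
    have := hr.ne hx
    omega
  · rw [hc _ x, hc _ y] at h2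
    obtain rfl := hinj _ _ _ _ (Ne.symm hx) (Ne.symm hy) h2
    rfl

theorem IsSched.comp {L : Type*} {s : Arc V → K} (hs : IsSched s) {g : K → L}
    (hg : Function.Injective g) : IsSched (g ∘ s) :=
  fun x y t hx hy h => hs x y t hx hy (hg h)

theorem IsSched.exists_arc [Fintype V] [Fintype K] {s : Arc V → K} (hs : IsSched s)
    (hK : Fintype.card K = 2 * (Fintype.card V - 1)) (t : V) (k : K) : ∃ x, Inc t x ∧ s x = k := by
  let F : Bool × {v // v ≠ t} → Arc V := fun p =>
    if p.1 then ⟨(t, p.2.1), p.2.2.symm⟩ else ⟨(p.2.1, t), p.2.2⟩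
  have hF : ∀ p, Inc t (F p) := by
    rintro ⟨b, v⟩
    cases b <;> simp [F, Inc]
  have hFinj : Function.Injective F := by
    rintro ⟨b, v, hv⟩ ⟨b', w, hw⟩ h
    cases b <;> cases b' <;> simp_all [F]
  have hb : Function.Bijective (s ∘ F) := by
    rw [Fintype.bijective_iff_injective_and_card]
    refine ⟨fun p q h => hFinj (hs _ _ t (hF p) (hF q) h), ?_⟩
    rw [hK]
    simp
  obtain ⟨p, hp⟩ := hb.2 k
  exact ⟨F p, hF p, hp⟩

/-- Permuting the slots of a set of matches that is closed under the permutation at every team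
yields a schedule again. -/
theorem IsSched.permute {s : Arc V → K} (hs : IsSched s) (E : Finset (Arc V)) (g : K ≃ K)
    (hE : ∀ x ∈ E, ∀ t, Inc t x → ∃ y ∈ E, Inc t y ∧ s y = g (s x)) :
    IsSched fun x => if x ∈ E then g (s x) else s x := by
  intro x y t hx hy h
  by_cases hxE : x ∈ E <;> by_cases hyE : y ∈ E <;> simp only [hxE, hyE, if_true, if_false] at h
  · exact hs x y t hx hy (g.injective h)
  · obtain ⟨z, hzE, hz, hsz⟩ := hE x hxE t hx
    exact absurd (hs z y t hz hy (hsz.trans h) ▸ hzE) hyE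
  · obtain ⟨z, hzE, hz, hsz⟩ := hE y hyE t hy
    exact absurd (hs z x t hz hx (hsz.trans h.symm) ▸ hzE) hxE
  · exact hs x y t hx hy h

theorem sum_permute_eq [Fintype V] {s : Arc V → K} (hs : IsSched s) {c : K → Arc V → ℝ} {γ : ℝ}
    (hc : ∀ s : Arc V → K, IsSched s → ∑ x, c (s x) x = γ) (E : Finset (Arc V)) (g : K ≃ K)
    (hE : ∀ x ∈ E, ∀ t, Inc t x → ∃ y ∈ E, Inc t y ∧ s y = g (s x)) :
    ∑ x ∈ E, c (g (s x)) x = ∑ x ∈ E, c (s x) x := by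
  have h1 := hc _ hs
  have h2 := hc _ (hs.permute E g hE)
  rw [← Finset.sum_add_sum_compl E] at h1 h2
  rw [Finset.sum_congr rfl (g := fun x => c (g (s x)) x) fun x hx => by simp [hx]] at h2
  rw [Finset.sum_congr rfl (s₁ := Eᶜ) (g := fun x => c (s x) x)
    fun x hx => by simp [Finset.mem_compl.1 hx]] at h2
  linarith

/-- Any prescribed 4-cycle occurs in the union of two slots of some schedule. -/
theorem exists_isSched_cycle [Fintype V] [Fintype K] (heven : Even (Fintype.card V))
    (hK : Fintype.card K = 2 * (Fintype.card V - 1)) {i j p q : V} (hij : i ≠ j) (hip : i ≠ p)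
    (hiq : i ≠ q) (hjp : j ≠ p) (hjq : j ≠ q) (hpq : p ≠ q) :
    ∃ s : Arc V → K, IsSched s ∧ s ⟨(i, j), hij⟩ = s ⟨(p, q), hpq⟩ ∧
      s ⟨(j, p), hjp⟩ = s ⟨(q, i), hiq.symm⟩ ∧ s ⟨(i, j), hij⟩ ≠ s ⟨(j, p), hjp⟩ := by
  have h4 : 4 ≤ Fintype.card V := by
    have : Function.Injective ![i, j, p, q] := by
      intro a b; fin_cases a <;> fin_cases b <;> simp [*, Ne.symm, eq_comm]
    simpa using Fintype.card_le_of_injective _ this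
  obtain ⟨m, hm⟩ : ∃ m, Fintype.card V = m + 1 := ⟨Fintype.card V - 1, by omega⟩
  have hodd : Odd m := by
    rw [hm] at heven
    rcases Nat.even_or_odd m with h | h
    · exact absurd heven (Nat.not_even_iff_odd.2 h.add_one)
    · exact h
  have : NeZero m := ⟨by omega⟩
  have : Fact (1 < m) := ⟨by omega⟩
  have e₀ : V ≃ Option (ZMod m) := Fintype.equivOfCardEq (by simp [hm, ZMod.card])
  have g : Bool × ZMod m ≃ K := Fintype.equivOfCardEq (by simp [hK, hm, ZMod.card])
  have h01 : (0 : ZMod m) ≠ 1 := zero_ne_one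
  have h1n : (1 : ZMod m) ≠ -1 := by
    intro h
    exact h01 (add_self_injective_of_odd hodd (by linear_combination (-1 : ZMod m) * h))
  have h0n : (0 : ZMod m) ≠ -1 := by simp [eq_comm]
  obtain ⟨e₁, h1i, h1j, h1p, h1q⟩ := exists_equiv_apply_four e₀ (a := i) (b := j) (c := p) (d := q)
    (a' := none) (b' := some 0) (c' := some 1) (d' := some (-1)) hij hip hiq hjp hjq hpq
    (by simp) (by simp) (by simp) (by simp) (by simp) (by simpa using h1n)
  obtain ⟨e₂, h2i, h2j, h2p, h2q⟩ := exists_equiv_apply_four e₀ (a := i) (b := j) (c := p) (d := q)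
    (a' := some (-1)) (b' := none) (c' := some 0) (d' := some 1) hij hip hiq hjp hjq hpq
    (by simp) (by simp) (by simpa using h1n.symm) (by simp) (by simp) (by simp)
  obtain ⟨e₃, h3i, h3p, h3j, h3q⟩ := exists_equiv_apply_four
    (Fintype.equivFin V) (a := i) (b := p) (c := j) (d := q)
    (a' := ⟨0, by omega⟩) (b' := ⟨1, by omega⟩) (c' := ⟨2, by omega⟩) (d' := ⟨3, by omega⟩)
    hip hij hiq hjp.symm hpq hjq (by simp) (by simp) (by simp) (by simp) (by simp) (by simp)
  refine ⟨_, isSched_of_colorings (c := fun b u v => cond b (circleColor m (e₁ u) (e₁ v))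
    (circleColor m (e₂ u) (e₂ v))) ?_ ?_ (r := fun v => (e₃ v : ℕ))
    (Fin.val_injective.comp e₃.injective) g, ?_, ?_, ?_⟩
  · intro b u v
    cases b <;> exact circleColor_comm _ _
  · intro b u v w huv huw h
    cases b
    · exact e₂.injective (circleColor_injective hodd (e₂.injective.ne huv) (e₂.injective.ne huw) h)
    · exact e₁.injective (circleColor_injective hodd (e₁.injective.ne huv) (e₁.injective.ne huw) h)
  · simp [h1i, h1j, h1p, h1q, h3i, h3j, h3p, h3q, circleColor]
  · simp [h2i, h2j, h2p, h2q, h3i, h3j, h3p, h3q, circleColor]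
  · simp [h3i, h3j, h3p]

/-- A function on edges with equal sums on the two matchings of each 4-cycle comes from a function
on the vertices. -/
theorem exists_eq_add_of_cycle {f : V → V → ℝ} (hV : ∃ u v w : V, u ≠ v ∧ u ≠ w ∧ v ≠ w)
    (hsymm : ∀ i j, i ≠ j → f i j = f j i)
    (hcyc : ∀ i j p q, i ≠ j → i ≠ p → i ≠ q → j ≠ p → j ≠ q → p ≠ q →
      f i j + f p q = f j p + f q i) :
    ∃ a : V → ℝ, ∀ i j, i ≠ j → f i j = a i + a j := by
  obtain ⟨u, v, w, huv, huw, hvw⟩ := hV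
  have key : ∀ x y z, u ≠ x → u ≠ y → u ≠ z → x ≠ y → y ≠ z →
      f x y - f u x - f u y = f z y - f u z - f u y := by
    intro x y z hx hy hz hxy hyz
    by_cases hxz : x = z
    · rw [hxz]
    have := hcyc x y z u hxy hxz hx.symm hyz hy.symm hz.symm
    rw [hsymm y z hyz, hsymm z u hz.symm] at this
    linarith
  have main : ∀ x y, u ≠ x → u ≠ y → x ≠ y →
      f x y - f u x - f u y = f v w - f u v - f u w := by
    intro x y hx hy hxy
    by_cases hyv : y = v
    · subst hyv
      rw [key x y w hx hy huw hxy hvw, hsymm w y hvw.symm]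
      ring
    · have h1 := key x y v hx hy huv hxy hyv
      have h2 := key y v w hy huv huw hyv hvw
      rw [hsymm y v hyv, hsymm w v hvw.symm] at h2
      linarith
  refine ⟨fun x => if x = u then (f u v + f u w - f v w) / 2 else
    f u x - (f u v + f u w - f v w) / 2, fun i j hij => ?_⟩
  by_cases hi : i = u
  · subst hi
    simp [hij.symm]
  · by_cases hj : j = u
    · subst hj
      simp [hij, hsymm i j hij]
    · have := main i j (Ne.symm hi) (Ne.symm hj) hij
      simp only [hi, hj, if_false]
      linarith

/-- Every linear equation satisfied by all schedules is a combination of the obvious ones. -/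
theorem exists_eq_of_sum_const [Fintype V] [Fintype K] (h4 : 4 ≤ Fintype.card V)
    (heven : Even (Fintype.card V)) (hK : Fintype.card K = 2 * (Fintype.card V - 1))
    {c : K → Arc V → ℝ} {γ : ℝ} (hc : ∀ s : Arc V → K, IsSched s → ∑ x, c (s x) x = γ) :
    ∃ (a : K → V → ℝ) (b : Arc V → ℝ), ∀ k x, c k x = a k x.1.1 + a k x.1.2 + b x := by
  classical
  have hV : ∃ u v w : V, u ≠ v ∧ u ≠ w ∧ v ≠ w := by
    let e := (Fintype.equivFin V).symm
    refine ⟨e ⟨0, by omega⟩, e ⟨1, by omega⟩, e ⟨2, by omega⟩, ?_⟩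
    simp
  have hcard : 0 < Fintype.card K := by omega
  obtain ⟨k₀⟩ := Fintype.card_pos_iff.1 hcard
  have hflip : ∀ k l (i j : V) (hij : i ≠ j), k ≠ l →
      c k ⟨(i, j), hij⟩ - c l ⟨(i, j), hij⟩ = c k ⟨(j, i), hij.symm⟩ - c l ⟨(j, i), hij.symm⟩ := by
    intro k l i j hij hkl
    obtain ⟨p, hpi, hpj⟩ : ∃ p : V, p ≠ i ∧ p ≠ j := by
      obtain ⟨p, hp⟩ := Finset.exists_mem_notMem_of_card_lt_card
        (s := {i, j}) (t := (Finset.univ : Finset V))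
        ((Finset.card_le_two).trans_lt (by rw [Finset.card_univ]; omega))
      simp at hp
      exact ⟨p, hp.1, hp.2⟩
    obtain ⟨q, hqi, hqj, hqp⟩ : ∃ q : V, q ≠ i ∧ q ≠ j ∧ q ≠ p := by
      obtain ⟨q, hq⟩ := Finset.exists_mem_notMem_of_card_lt_card
        (s := {i, j, p}) (t := (Finset.univ : Finset V))
        ((Finset.card_le_three).trans_lt (by rw [Finset.card_univ]; omega))
      simp at hq
      exact ⟨q, hq.1, hq.2.1, hq.2.2⟩
    obtain ⟨s₀, hs₀, -⟩ := exists_isSched_cycle heven hK hij hpi.symm hqi.symm hpj.symm hqj.symm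
      hqp.symm
    have hne : s₀ ⟨(i, j), hij⟩ ≠ s₀ ⟨(j, i), hij.symm⟩ := fun h => hij <| by
      simpa using congrArg (fun x => x.1.1)
        (hs₀ ⟨(i, j), hij⟩ ⟨(j, i), hij.symm⟩ i (Or.inl rfl) (Or.inr rfl) h)
    obtain ⟨g, hgk, hgl⟩ := exists_equiv_apply_two (Equiv.refl K) hne hkl
    have hs := hs₀.comp g.injective
    have := sum_permute_eq hs hc {⟨(i, j), hij⟩, ⟨(j, i), hij.symm⟩} (Equiv.swap k l) ?_
    · rw [Finset.sum_pair (by simp [hij]), Finset.sum_pair (by simp [hij])] at this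
      simp only [Function.comp, hgk, hgl, Equiv.swap_apply_left, Equiv.swap_apply_right] at this
      linarith
    · simp [Inc, hgk, hgl, or_comm]
  have hcyc : ∀ k l (i j p q : V) (hij : i ≠ j) (hip : i ≠ p) (hiq : i ≠ q) (hjp : j ≠ p)
      (hjq : j ≠ q) (hpq : p ≠ q), k ≠ l →
      c k ⟨(i, j), hij⟩ - c l ⟨(i, j), hij⟩ + (c k ⟨(p, q), hpq⟩ - c l ⟨(p, q), hpq⟩) =
      c k ⟨(j, p), hjp⟩ - c l ⟨(j, p), hjp⟩ +
        (c k ⟨(q, i), hiq.symm⟩ - c l ⟨(q, i), hiq.symm⟩) := by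
    intro k l i j p q hij hip hiq hjp hjq hpq hkl
    obtain ⟨s₀, hs₀, h1, h2, hne⟩ := exists_isSched_cycle heven hK hij hip hiq hjp hjq hpq
    obtain ⟨g, hgk, hgl⟩ := exists_equiv_apply_two (Equiv.refl K) hne hkl
    have hs := hs₀.comp g.injective
    have := sum_permute_eq hs hc {⟨(i, j), hij⟩, ⟨(p, q), hpq⟩, ⟨(j, p), hjp⟩, ⟨(q, i), hiq.symm⟩}
      (Equiv.swap k l) ?_
    · have e1 : ∀ F : Arc V → ℝ, ∑ x ∈ {⟨(i, j), hij⟩, ⟨(p, q), hpq⟩, ⟨(j, p), hjp⟩,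
          ⟨(q, i), hiq.symm⟩}, F x = F ⟨(i, j), hij⟩ + (F ⟨(p, q), hpq⟩ + (F ⟨(j, p), hjp⟩ +
          F ⟨(q, i), hiq.symm⟩)) := by
        intro F
        rw [Finset.sum_insert, Finset.sum_insert, Finset.sum_pair]
        all_goals simp [*, Ne.symm]
      rw [e1, e1] at this
      simp only [Function.comp, ← h1, ← h2, hgk, hgl, Equiv.swap_apply_left,
        Equiv.swap_apply_right] at this
      linarith
    · have hgk' : g (s₀ ⟨(p, q), hpq⟩) = k := by rw [← h1, hgk]
      have hgl' : g (s₀ ⟨(q, i), hiq.symm⟩) = l := by rw [← h2, hgl]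
      simp only [Finset.mem_insert, Finset.mem_singleton, Function.comp]
      rintro x (rfl | rfl | rfl | rfl) t (rfl | rfl) <;>
        simp [Inc, hgk, hgl, hgk', hgl']
  have hdiff : ∀ k, ∃ a : V → ℝ, ∀ i j (hij : i ≠ j),
      c k ⟨(i, j), hij⟩ - c k₀ ⟨(i, j), hij⟩ = a i + a j := by
    intro k
    by_cases hk : k = k₀
    · exact ⟨0, by simp [hk]⟩
    let f : V → V → ℝ := fun i j =>
      if h : i ≠ j then c k ⟨(i, j), h⟩ - c k₀ ⟨(i, j), h⟩ else 0
    have hfe : ∀ i j (hij : i ≠ j), f i j = c k ⟨(i, j), hij⟩ - c k₀ ⟨(i, j), hij⟩ :=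
      fun i j hij => dif_pos hij
    have hsymm : ∀ i j, i ≠ j → f i j = f j i := fun i j hij => by
      rw [hfe i j hij, hfe j i hij.symm, hflip _ _ _ _ _ hk]
    have hcyc' : ∀ i j p q, i ≠ j → i ≠ p → i ≠ q → j ≠ p → j ≠ q → p ≠ q →
        f i j + f p q = f j p + f q i := fun i j p q hij hip hiq hjp hjq hpq => by
      rw [hfe i j hij, hfe p q hpq, hfe j p hjp, hfe q i hiq.symm]
      exact hcyc k k₀ i j p q hij hip hiq hjp hjq hpq hk
    obtain ⟨a, ha⟩ := exists_eq_add_of_cycle hV hsymm hcyc'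
    exact ⟨a, fun i j hij => (hfe i j hij).symm.trans (ha i j hij)⟩
  choose a ha using hdiff
  refine ⟨a, c k₀, ?_⟩
  rintro k ⟨⟨i, j⟩, hij⟩
  have := ha k i j hij
  simp only
  linarith

end Schedules

/-! ### The equation space -/

section Equations

variable (V K : Type*)

/-- The coefficients of the combination of slot-team equations with multipliers `a` and pairing
equations with multipliers `b`. -/
def coeffMap : (K × V → ℝ) × (Arc V → ℝ) →ₗ[ℝ] (K × Arc V → ℝ) where
  toFun p := fun y => p.1 (y.1, y.2.1.1) + p.1 (y.1, y.2.1.2) + p.2 y.2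
  map_add' p q := by
    ext y
    simp only [Prod.fst_add, Prod.snd_add, Pi.add_apply]
    ring
  map_smul' r p := by
    ext y
    simp only [Prod.smul_fst, Prod.smul_snd, Pi.smul_apply, smul_eq_mul, RingHom.id_apply]
    ring

/-- The multipliers of the dependencies: a team plays in as many slots as it has pairings. -/
def dependencyMap : (V → ℝ) →ₗ[ℝ] (K × V → ℝ) × (Arc V → ℝ) where
  toFun α := (fun y => α y.2, fun x => -(α x.1.1 + α x.1.2))
  map_add' α β := by
    ext x
    · rfl
    · simp only [Pi.add_apply, Prod.mk_add_mk]
      ring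
  map_smul' r α := by
    ext x
    · rfl
    · simp only [Pi.smul_apply, Prod.smul_mk, smul_eq_mul, RingHom.id_apply]
      ring

variable {V K}

theorem dependencyMap_injective [Nonempty K] : Function.Injective (dependencyMap V K) := by
  intro α β h
  obtain ⟨k⟩ := ‹Nonempty K›
  ext t
  exact congrFun (congrArg Prod.fst h) (k, t)

theorem ker_coeffMap [Fintype V] [Nonempty K] (h3 : 3 ≤ Fintype.card V) :
    LinearMap.ker (coeffMap V K) = LinearMap.range (dependencyMap V K) := by
  classical
  ext ⟨a, b⟩
  constructor
  · intro h
    have h : ∀ k i j, i ≠ j → ∀ hij, a (k, i) + a (k, j) + b ⟨(i, j), hij⟩ = 0 :=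
      fun k i j _ hij => congrFun h (k, ⟨(i, j), hij⟩)
    obtain ⟨k₀⟩ := ‹Nonempty K›
    have hconst : ∀ k t, a (k, t) = a (k₀, t) := by
      intro k t
      obtain ⟨i, hi⟩ := Finset.exists_mem_notMem_of_card_lt_card
        (s := {t}) (t := (Finset.univ : Finset V)) (by
          rw [Finset.card_univ, Finset.card_singleton]; omega)
      obtain ⟨j, hj⟩ := Finset.exists_mem_notMem_of_card_lt_card
        (s := {t, i}) (t := (Finset.univ : Finset V))
        ((Finset.card_le_two).trans_lt (by rw [Finset.card_univ]; omega))
      simp only [Finset.mem_univ, Finset.mem_singleton, Finset.mem_insert, true_and,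
        not_or] at hi hj
      have e1 := h k t i (Ne.symm hi) (Ne.symm hi)
      have e2 := h k t j (Ne.symm hj.1) (Ne.symm hj.1)
      have e3 := h k i j (Ne.symm hj.2) (Ne.symm hj.2)
      have e4 := h k₀ t i (Ne.symm hi) (Ne.symm hi)
      have e5 := h k₀ t j (Ne.symm hj.1) (Ne.symm hj.1)
      have e6 := h k₀ i j (Ne.symm hj.2) (Ne.symm hj.2)
      linarith
    refine ⟨fun t => a (k₀, t), ?_⟩
    ext x
    · exact (hconst x.1 x.2).symm
    · have := h k₀ x.1.1 x.1.2 x.2 x.2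
      simp only [dependencyMap, LinearMap.coe_mk, AddHom.coe_mk]
      linarith
  · rintro ⟨α, h⟩
    rw [← h, LinearMap.mem_ker]
    ext y
    simp [coeffMap, dependencyMap]

theorem card_arc [Fintype V] [DecidableEq V] :
    Fintype.card (Arc V) = Fintype.card V * Fintype.card V - Fintype.card V := by
  rw [Fintype.card_subtype, ← Finset.card_univ (α := V), ← Finset.offDiag_card]
  congr 1
  ext p
  simp

theorem finrank_range_coeffMap [Fintype V] [Fintype K] [Nonempty K] (h3 : 3 ≤ Fintype.card V) :
    Module.finrank ℝ (LinearMap.range (coeffMap V K)) + Fintype.card V =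
      Fintype.card K * Fintype.card V + (Fintype.card V * Fintype.card V - Fintype.card V) := by
  classical
  have h := LinearMap.finrank_range_add_finrank_ker (coeffMap V K)
  rw [ker_coeffMap h3, LinearMap.finrank_range_of_inj dependencyMap_injective,
    Module.finrank_prod, Module.finrank_fintype_fun_eq_card, Module.finrank_fintype_fun_eq_card,
    Module.finrank_fintype_fun_eq_card, Fintype.card_prod, card_arc] at h
  exact h

end Equations

/-! ### Tournaments from schedules -/

section Tournaments

variable {n : ℕ}

/-- The teams `1, …, n`. -/
abbrev Team (n : ℕ) := {t : ℕ // t ∈ Finset.Icc 1 n}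

/-- The slots `1, …, 2n-2`. -/
abbrev Slot (n : ℕ) := {k : ℕ // k ∈ Finset.Icc 1 (2 * n - 2)}

/-- Matches as pairs of a slot and an arc. -/
def matchEquiv (n : ℕ) : Slot n × Arc (Team n) ≃ {m : ℕ × ℕ × ℕ // IsMatch n m} where
  toFun p := ⟨(p.1.1, p.2.1.1.1, p.2.1.2.1), by
    obtain ⟨⟨k, hk⟩, ⟨⟨i, hi⟩, ⟨j, hj⟩⟩, h⟩ := p
    simp only [Finset.mem_Icc, ne_eq, Subtype.mk.injEq] at hk hi hj h
    exact ⟨hk.1, hk.2, hi.1, hi.2, hj.1, hj.2, h⟩⟩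
  invFun m := (⟨m.1.1, Finset.mem_Icc.2 ⟨m.2.1, m.2.2.1⟩⟩,
    ⟨(⟨m.1.2.1, Finset.mem_Icc.2 ⟨m.2.2.2.1, m.2.2.2.2.1⟩⟩,
      ⟨m.1.2.2, Finset.mem_Icc.2 ⟨m.2.2.2.2.2.1, m.2.2.2.2.2.2.1⟩⟩),
      fun h => m.2.2.2.2.2.2.2 (congrArg Subtype.val h)⟩)
  left_inv _ := rfl
  right_inv _ := rfl

/-- Travel indices as pairs of a team and an arc. -/
def travelEquiv (n : ℕ) : Team n × Arc (Team n) ≃ {p : ℕ × ℕ × ℕ // IsTravelIdx n p} where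
  toFun p := ⟨(p.1.1, p.2.1.1.1, p.2.1.2.1), by
    obtain ⟨⟨k, hk⟩, ⟨⟨i, hi⟩, ⟨j, hj⟩⟩, h⟩ := p
    simp only [Finset.mem_Icc, ne_eq, Subtype.mk.injEq] at hk hi hj h
    exact ⟨hk.1, hk.2, hi.1, hi.2, hj.1, hj.2, h⟩⟩
  invFun m := (⟨m.1.1, Finset.mem_Icc.2 ⟨m.2.1, m.2.2.1⟩⟩,
    ⟨(⟨m.1.2.1, Finset.mem_Icc.2 ⟨m.2.2.2.1, m.2.2.2.2.1⟩⟩,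
      ⟨m.1.2.2, Finset.mem_Icc.2 ⟨m.2.2.2.2.2.1, m.2.2.2.2.2.2.1⟩⟩),
      fun h => m.2.2.2.2.2.2.2 (congrArg Subtype.val h)⟩)
  left_inv _ := rfl
  right_inv _ := rfl

noncomputable instance : Fintype {m : ℕ × ℕ × ℕ // IsMatch n m} :=
  Fintype.ofEquiv _ (matchEquiv n)

noncomputable instance : Fintype {p : ℕ × ℕ × ℕ // IsTravelIdx n p} :=
  Fintype.ofEquiv _ (travelEquiv n)

theorem card_team : Fintype.card (Team n) = n := by simp

theorem card_slot : Fintype.card (Slot n) = 2 * (Fintype.card (Team n) - 1) := by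
  simp
  omega

/-- The set of matches of a schedule. -/
def tour (s : Arc (Team n) → Slot n) : Set (ℕ × ℕ × ℕ) :=
  Set.range fun x => (matchEquiv n (s x, x)).1

theorem matchEquiv_mem_tour {s : Arc (Team n) → Slot n} {k : Slot n} {x : Arc (Team n)} :
    (matchEquiv n (k, x)).1 ∈ tour s ↔ s x = k := by
  constructor
  · rintro ⟨y, hy⟩
    have := (matchEquiv n).injective (Subtype.ext hy)
    simp only [Prod.mk.injEq] at this
    obtain ⟨h, rfl⟩ := this
    exact h
  · rintro rfl
    exact ⟨x, rfl⟩

theorem inc_iff {t : Team n} {k : Slot n} {x : Arc (Team n)} :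
    Inc t x ↔ t.1 = (matchEquiv n (k, x)).1.2.1 ∨ t.1 = (matchEquiv n (k, x)).1.2.2 := by
  simp only [Inc, Subtype.ext_iff]
  rfl

theorem IsSched.isTournament {s : Arc (Team n) → Slot n} (hs : IsSched s) :
    IsTournament n (tour s) where
  subset := by
    rintro _ ⟨x, rfl⟩
    exact (matchEquiv n (s x, x)).2
  slot_team := by
    intro k hk1 hk2 t ht1 ht2
    obtain ⟨x, hx, hsx⟩ := hs.exists_arc card_slot ⟨t, Finset.mem_Icc.2 ⟨ht1, ht2⟩⟩
      ⟨k, Finset.mem_Icc.2 ⟨hk1, hk2⟩⟩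
    refine ⟨(matchEquiv n (s x, x)).1, ⟨⟨x, rfl⟩, congrArg Subtype.val hsx, inc_iff.1 hx⟩, ?_⟩
    rintro _ ⟨⟨y, rfl⟩, hyk, hyt⟩
    have hy : Inc ⟨t, Finset.mem_Icc.2 ⟨ht1, ht2⟩⟩ y := inc_iff.2 hyt
    have : y = x := hs y x _ hy hx (by rw [hsx]; exact Subtype.ext hyk)
    rw [this]
  pair := by
    intro i j hi1 hi2 hj1 hj2 hij
    let x : Arc (Team n) := ⟨(⟨i, Finset.mem_Icc.2 ⟨hi1, hi2⟩⟩, ⟨j, Finset.mem_Icc.2 ⟨hj1, hj2⟩⟩),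
      fun h => hij (congrArg Subtype.val h)⟩
    refine ⟨(s x).1, ⟨x, rfl⟩, ?_⟩
    rintro k ⟨y, hy⟩
    have h2 : y = x := by
      refine Subtype.ext (Prod.ext (Subtype.ext ?_) (Subtype.ext ?_))
      · exact congrArg (fun m : ℕ × ℕ × ℕ => m.2.1) hy
      · exact congrArg (fun m : ℕ × ℕ × ℕ => m.2.2) hy
    rw [← h2]
    exact (congrArg Prod.fst hy).symm

theorem IsTournament.existsUnique_arc {T : Set (ℕ × ℕ × ℕ)} (hT : IsTournament n T) (k : Slot n)
    (t : Team n) : ∃! x : Arc (Team n), Inc t x ∧ (matchEquiv n (k, x)).1 ∈ T := by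
  obtain ⟨m, ⟨hm, hmk, hmt⟩, huniq⟩ := hT.slot_team k.1 (Finset.mem_Icc.1 k.2).1
    (Finset.mem_Icc.1 k.2).2 t.1 (Finset.mem_Icc.1 t.2).1 (Finset.mem_Icc.1 t.2).2
  obtain ⟨⟨k', x⟩, hx⟩ := (matchEquiv n).surjective ⟨m, hT.subset m hm⟩
  have hx : (matchEquiv n (k', x)).1 = m := congrArg Subtype.val hx
  subst hx
  obtain rfl : k' = k := Subtype.ext hmk
  refine ⟨x, ⟨inc_iff.2 hmt, hm⟩, ?_⟩
  rintro y ⟨hy1, hy2⟩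
  have := huniq _ ⟨hy2, rfl, inc_iff.1 hy1⟩
  exact congrArg Prod.snd ((matchEquiv n).injective (Subtype.ext this))

theorem IsTournament.existsUnique_slot {T : Set (ℕ × ℕ × ℕ)} (hT : IsTournament n T)
    (x : Arc (Team n)) : ∃! k : Slot n, (matchEquiv n (k, x)).1 ∈ T := by
  obtain ⟨⟨⟨i, hi⟩, ⟨j, hj⟩⟩, hij⟩ := x
  have hi' := Finset.mem_Icc.1 hi
  have hj' := Finset.mem_Icc.1 hj
  obtain ⟨k, hk, huniq⟩ := hT.pair i j hi'.1 hi'.2 hj'.1 hj'.2 (fun h => hij (Subtype.ext h))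
  have hk' := hT.subset _ hk
  exact ⟨⟨k, Finset.mem_Icc.2 ⟨hk'.1, hk'.2.1⟩⟩, hk, fun l hl => Subtype.ext (huniq _ hl)⟩

theorem sum_ite_eq_one_of_existsUnique {ι : Type*} [Fintype ι] {P : ι → Prop} [DecidablePred P]
    (h : ∃! i, P i) : ∑ i, (if P i then (1 : ℝ) else 0) = 1 := by
  obtain ⟨i, hi, huniq⟩ := h
  rw [Fintype.sum_eq_single i fun j hj => if_neg fun h => hj (huniq j h), if_pos hi]

theorem sum_inc_eq {V : Type*} [Fintype V] (x : Arc V) (f : V → ℝ) :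
    ∑ t, (if Inc t x then f t else 0) = f x.1.1 + f x.1.2 := by
  rw [← Finset.sum_filter, ← Finset.sum_pair x.2]
  congr 1
  ext t
  rw [Finset.mem_filter]
  simp [Inc]

/-- The left hand sides of the equations are constant on tournaments. -/
theorem IsTournament.sum_coeffMap {T : Set (ℕ × ℕ × ℕ)} (hT : IsTournament n T)
    (p : (Slot n × Team n → ℝ) × (Arc (Team n) → ℝ)) :
    ∑ y, coeffMap _ _ p y * play T (matchEquiv n y).1 = ∑ y, p.1 y + ∑ x, p.2 x := by
  obtain ⟨a, b⟩ := p
  simp only [coeffMap, LinearMap.coe_mk, AddHom.coe_mk, add_mul _ (b _), Finset.sum_add_distrib]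
  congr 1
  · rw [Fintype.sum_prod_type, Fintype.sum_prod_type]
    refine Finset.sum_congr rfl fun k _ => ?_
    calc ∑ x, (a (k, x.1.1) + a (k, x.1.2)) * play T (matchEquiv n (k, x)).1
        = ∑ x : Arc (Team n), ∑ t, a (k, t) *
            (if Inc t x ∧ (matchEquiv n (k, x)).1 ∈ T then 1 else 0) := by
          refine Finset.sum_congr rfl fun x _ => ?_
          rw [← sum_inc_eq x (fun t => a (k, t)), Finset.sum_mul]
          refine Finset.sum_congr rfl fun t _ => ?_
          by_cases h1 : Inc t x <;> by_cases h2 : (matchEquiv n (k, x)).1 ∈ T <;>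
            simp [play, h1, h2]
      _ = ∑ t, a (k, t) := by
          rw [Finset.sum_comm]
          refine Finset.sum_congr rfl fun t _ => ?_
          rw [← Finset.mul_sum, sum_ite_eq_one_of_existsUnique (hT.existsUnique_arc k t), mul_one]
  · rw [Fintype.sum_prod_type, Finset.sum_comm]
    refine Finset.sum_congr rfl fun x _ => ?_
    change ∑ k, b x * play T (matchEquiv n (k, x)).1 = b x
    rw [← Finset.mul_sum]
    simp only [play]
    rw [sum_ite_eq_one_of_existsUnique (hT.existsUnique_slot x), mul_one]

theorem sum_play_tour (s : Arc (Team n) → Slot n) (c : Slot n × Arc (Team n) → ℝ) :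
    ∑ y, c y * play (tour s) (matchEquiv n y).1 = ∑ x, c (s x, x) := by
  rw [Fintype.sum_prod_type, Finset.sum_comm]
  refine Finset.sum_congr rfl fun x _ => ?_
  simp [play, matchEquiv_mem_tour]

/-! ### Travel -/

theorem mem_of_venue_eq {T : Set (ℕ × ℕ × ℕ)} {t k v : ℕ} (h : venue T t k = v) (hv : v ≠ t) :
    (k, v, t) ∈ T := by
  unfold venue at h
  split_ifs at h with hex
  · obtain ⟨j, hj, hor⟩ := hex.choose_spec
    rw [h] at hj hor
    rcases hor with hor | hor
    · exact absurd hor.symm hv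
    · rwa [hor]
  · exact absurd h.symm hv

theorem IsTournament.venue_eq {T : Set (ℕ × ℕ × ℕ)} (hT : IsTournament n T) {t k v : ℕ}
    (h : (k, v, t) ∈ T) : venue T t k = v := by
  have hex : ∃ i, ∃ j, (k, i, j) ∈ T ∧ (t = i ∨ t = j) := ⟨v, t, h, Or.inr rfl⟩
  obtain ⟨j, hj, hor⟩ := hex.choose_spec
  rw [venue, dif_pos hex]
  have hm := hT.subset _ h
  have := (hT.slot_team k hm.1 hm.2.1 t hm.2.2.2.2.1 hm.2.2.2.2.2.1).unique
    ⟨h, rfl, Or.inr rfl⟩ ⟨hj, rfl, hor⟩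
  exact (congrArg (fun m : ℕ × ℕ × ℕ => m.2.1) this).symm

theorem IsTournament.slot_unique {T : Set (ℕ × ℕ × ℕ)} (hT : IsTournament n T) {i j k l : ℕ}
    (hk : (k, i, j) ∈ T) (hl : (l, i, j) ∈ T) : k = l := by
  have hm := hT.subset _ hk
  exact (hT.pair i j hm.2.2.1 hm.2.2.2.1 hm.2.2.2.2.1 hm.2.2.2.2.2.1 hm.2.2.2.2.2.2).unique hk hl

/-- There are tournaments with two prescribed away matches of a team in the first two slots. -/
theorem exists_isTournament_away (hn : 4 ≤ n) (heven : Even n) {x y t : ℕ} (hx1 : 1 ≤ x)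
    (hxn : x ≤ n) (hy1 : 1 ≤ y) (hyn : y ≤ n) (ht1 : 1 ≤ t) (htn : t ≤ n) (hxy : x ≠ y)
    (hxt : x ≠ t) (hyt : y ≠ t) :
    ∃ T, IsTournament n T ∧ (1, x, t) ∈ T ∧ (2, y, t) ∈ T := by
  have hx : x ∈ Finset.Icc 1 n := Finset.mem_Icc.2 ⟨hx1, hxn⟩
  have hy : y ∈ Finset.Icc 1 n := Finset.mem_Icc.2 ⟨hy1, hyn⟩
  have ht : t ∈ Finset.Icc 1 n := Finset.mem_Icc.2 ⟨ht1, htn⟩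
  obtain ⟨z, hz⟩ := Finset.exists_mem_notMem_of_card_lt_card
    (s := {x, y, t}) (t := Finset.Icc 1 n)
    ((Finset.card_le_three).trans_lt (by rw [Nat.card_Icc]; omega))
  simp only [Finset.mem_insert, Finset.mem_singleton, not_or] at hz
  obtain ⟨hz, hzx, hzy, hzt⟩ := hz
  obtain ⟨s₀, hs₀, -⟩ := exists_isSched_cycle (V := Team n) (K := Slot n)
    (by rwa [card_team]) card_slot
    (i := ⟨x, hx⟩) (j := ⟨y, hy⟩) (p := ⟨t, ht⟩) (q := ⟨z, hz⟩)
    (by simpa using hxy) (by simpa using hxt) (by simpa using Ne.symm hzx) (by simpa using hyt)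
    (by simpa using Ne.symm hzy) (by simpa using Ne.symm hzt)
  let ax : Arc (Team n) := ⟨(⟨x, hx⟩, ⟨t, ht⟩), by simpa using hxt⟩
  let ay : Arc (Team n) := ⟨(⟨y, hy⟩, ⟨t, ht⟩), by simpa using hyt⟩
  have hne : s₀ ax ≠ s₀ ay := fun h => hxy
    (congrArg (fun a : Arc (Team n) => (a.1.1 : ℕ))
      (hs₀ ax ay ⟨t, ht⟩ (Or.inr rfl) (Or.inr rfl) h))
  obtain ⟨g, hgx, hgy⟩ := exists_equiv_apply_two (Equiv.refl (Slot n)) hne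
    (c := ⟨1, Finset.mem_Icc.2 ⟨le_rfl, by omega⟩⟩) (d := ⟨2, Finset.mem_Icc.2 ⟨by omega, by omega⟩⟩)
    (by simp)
  refine ⟨tour (g ∘ s₀), (hs₀.comp g.injective).isTournament, ?_, ?_⟩
  · exact (matchEquiv_mem_tour (s := g ∘ s₀) (x := ax)).2 hgx
  · exact (matchEquiv_mem_tour (s := g ∘ s₀) (x := ay)).2 hgy

theorem exists_isTournament_travel_eq_zero (hn : 4 ≤ n) (heven : Even n) {p : ℕ × ℕ × ℕ}
    (hp : IsTravelIdx n p) : ∃ T, IsTournament n T ∧ travel n T p = 0 := by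
  obtain ⟨t, i, j⟩ := p
  obtain ⟨ht1, htn, hi1, hin, hj1, hjn, hij⟩ := hp
  simp only at ht1 htn hi1 hin hj1 hjn hij
  obtain ⟨r, hr⟩ := Finset.exists_mem_notMem_of_card_lt_card
    (s := {i, j}) (t := Finset.Icc 1 n)
    ((Finset.card_le_two).trans_lt (by rw [Nat.card_Icc]; omega))
  simp only [Finset.mem_insert, Finset.mem_singleton, not_or, Finset.mem_Icc] at hr
  obtain ⟨⟨hr1, hrn⟩, hri, hrj⟩ := hr
  by_cases hit : i = t
  · subst hit
    obtain ⟨T, hT, h1, h2⟩ := exists_isTournament_away hn heven hr1 hrn hj1 hjn ht1 htn hrj hri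
      (Ne.symm hij)
    refine ⟨T, hT, if_neg ?_⟩
    rintro ⟨k, -, hki, hkj⟩
    have := hT.slot_unique (mem_of_venue_eq hkj (Ne.symm hij)) h2
    obtain rfl : k = 1 := by omega
    exact hri ((hT.venue_eq h1).symm.trans hki)
  by_cases hjt : j = t
  · subst hjt
    obtain ⟨T, hT, h1, h2⟩ := exists_isTournament_away hn heven hi1 hin hr1 hrn ht1 htn
      (Ne.symm hri) hij hrj
    refine ⟨T, hT, if_neg ?_⟩
    rintro ⟨k, -, hki, hkj⟩
    obtain rfl := hT.slot_unique (mem_of_venue_eq hki hij) h1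
    exact hrj ((hT.venue_eq h2).symm.trans hkj)
  · obtain ⟨T, hT, h1, h2⟩ := exists_isTournament_away hn heven hj1 hjn hi1 hin ht1 htn
      (Ne.symm hij) hjt hit
    refine ⟨T, hT, if_neg ?_⟩
    rintro ⟨k, -, hki, hkj⟩
    have e1 := hT.slot_unique (mem_of_venue_eq hki hit) h2
    have e2 := hT.slot_unique (mem_of_venue_eq hkj hjt) h1
    omega

end Tournaments

/-! ### The dimension -/

section Dimension

variable {n : ℕ}

/-- The points spanning `Ptt n`. -/
def vertices (n : ℕ) : Set (Pt n) :=
  { z : Pt n | ∃ T : Set (ℕ × ℕ × ℕ), IsTournament n T ∧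
    (∀ m : {m : ℕ × ℕ × ℕ // IsMatch n m}, z.1 m = play T m.1) ∧
    (∀ p : {p : ℕ × ℕ × ℕ // IsTravelIdx n p}, z.2 p = 0 ∨ z.2 p = 1) ∧
    (∀ p : {p : ℕ × ℕ × ℕ // IsTravelIdx n p}, travel n T p.1 ≤ z.2 p) }

theorem travel_le_one (T : Set (ℕ × ℕ × ℕ)) (p : ℕ × ℕ × ℕ) : travel n T p ≤ 1 := by
  unfold travel
  split_ifs <;> simp

theorem IsTournament.mem_vertices {T : Set (ℕ × ℕ × ℕ)} (hT : IsTournament n T) :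
    ((fun m => play T m.1, fun _ => 1) : Pt n) ∈ vertices n :=
  ⟨T, hT, fun _ => rfl, fun _ => Or.inr rfl, fun p => travel_le_one T p.1⟩

theorem single_mem_vectorSpan (hn : 4 ≤ n) (heven : Even n)
    (p : {p : ℕ × ℕ × ℕ // IsTravelIdx n p}) :
    ((0, Pi.single p 1) : Pt n) ∈ vectorSpan ℝ (vertices n) := by
  obtain ⟨T, hT, hTp⟩ := exists_isTournament_travel_eq_zero hn heven p.2
  have h0 : ((fun m => play T m.1, fun q => if q = p then 0 else 1) : Pt n) ∈ vertices n := by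
    refine ⟨T, hT, fun _ => rfl, fun q => ?_, fun q => ?_⟩
    · by_cases h : q = p <;> simp [h]
    · by_cases h : q = p
      · simp [h, hTp]
      · simpa [h] using travel_le_one T q.1
  convert vsub_mem_vectorSpan ℝ hT.mem_vertices h0 using 1
  ext q
  · simp
  · by_cases h : q = p
    · subst h
      simp
    · simp [h]

/-- The linear form on `Pt n` with coefficients `c` on the play coordinates. -/
noncomputable def playForm (n : ℕ) :
    (Slot n × Arc (Team n) → ℝ) →ₗ[ℝ] Module.Dual ℝ (Pt n) where
  toFun c :=
    { toFun := fun z => ∑ y, c y * z.1 (matchEquiv n y)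
      map_add' := fun z w => by simp [mul_add, Finset.sum_add_distrib]
      map_smul' := fun r z => by simp [Finset.mul_sum, mul_left_comm] }
  map_add' c d := by
    refine LinearMap.ext fun z => ?_
    simp [add_mul, Finset.sum_add_distrib]
  map_smul' r c := by
    refine LinearMap.ext fun z => ?_
    simp [Finset.mul_sum, mul_assoc]

theorem playForm_apply (c : Slot n × Arc (Team n) → ℝ) (z : Pt n) :
    playForm n c z = ∑ y, c y * z.1 (matchEquiv n y) := rfl

theorem playForm_single (c : Slot n × Arc (Team n) → ℝ) (y : Slot n × Arc (Team n)) :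
    playForm n c (Pi.single (matchEquiv n y) 1, 0) = c y := by
  rw [playForm_apply, Fintype.sum_eq_single y]
  · simp
  · intro w hw
    simp [hw]

theorem playForm_injective : Function.Injective (playForm n) := by
  intro c d h
  ext y
  rw [← playForm_single c y, h, playForm_single]

theorem dualAnnihilator_vectorSpan (hn : 4 ≤ n) (heven : Even n) :
    (vectorSpan ℝ (vertices n)).dualAnnihilator =
      (LinearMap.range (coeffMap (Team n) (Slot n))).map (playForm n) := by
  ext φ
  rw [Submodule.mem_dualAnnihilator]
  constructor
  · intro h
    let c : Slot n × Arc (Team n) → ℝ := fun y => φ (Pi.single (matchEquiv n y) 1, 0)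
    have hφ : φ = playForm n c := by
      refine LinearMap.prod_ext (LinearMap.pi_ext' fun m => LinearMap.ext_ring ?_)
        (LinearMap.pi_ext' fun p => LinearMap.ext_ring ?_)
      · obtain ⟨y, rfl⟩ := (matchEquiv n).surjective m
        simp only [LinearMap.comp_apply, LinearMap.inl_apply, LinearMap.single_apply]
        rw [playForm_single]
      · simp only [LinearMap.comp_apply, LinearMap.inr_apply, LinearMap.single_apply]
        rw [h _ (single_mem_vectorSpan hn heven p)]
        simp [playForm_apply]
    obtain ⟨T₀, hT₀, -⟩ := exists_isTournament_away hn heven (x := 1) (y := 2) (t := 3)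
      (by omega) (by omega) (by omega) (by omega) (by omega) (by omega) (by omega) (by omega)
      (by omega)
    obtain ⟨a, b, hab⟩ := exists_eq_of_sum_const (V := Team n) (K := Slot n)
      (c := fun k x => c (k, x)) (by rwa [card_team]) (by rwa [card_team]) card_slot
      (γ := φ (fun m => play T₀ m.1, fun _ => 1)) (fun s hs => by
        have := h _ (vsub_mem_vectorSpan ℝ hs.isTournament.mem_vertices hT₀.mem_vertices)
        rw [vsub_eq_sub, map_sub] at this
        nth_rewrite 1 [hφ] at this
        convert (sum_play_tour s c).symm.trans (sub_eq_zero.1 this))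
    refine ⟨c, ⟨(fun y => a y.1 y.2, b), ?_⟩, hφ.symm⟩
    ext y
    exact (hab y.1 y.2).symm
  · rintro ⟨_, ⟨p, rfl⟩, rfl⟩ w hw
    have hconst : ∀ z ∈ vertices n, playForm n (coeffMap _ _ p) z = ∑ y, p.1 y + ∑ x, p.2 x := by
      rintro z ⟨T, hT, hz, -⟩
      rw [← hT.sum_coeffMap p, playForm_apply]
      simp only [hz]
    have hle : vectorSpan ℝ (vertices n) ≤ LinearMap.ker (playForm n (coeffMap _ _ p)) := by
      refine Submodule.span_le.2 ?_
      rintro _ ⟨z, hz, z', hz', rfl⟩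
      simp [hconst z hz, hconst z' hz']
    exact hle hw

theorem finrank_pt (n : ℕ) : Module.finrank ℝ (Pt n) =
    (2 * n - 2) * (n * n - n) + n * (n * n - n) := by
  rw [Module.finrank_prod, Module.finrank_fintype_fun_eq_card, Module.finrank_fintype_fun_eq_card,
    ← Fintype.card_congr (matchEquiv n), ← Fintype.card_congr (travelEquiv n), Fintype.card_prod,
    Fintype.card_prod, card_arc, card_team]
  simp

end Dimension

/-- the dimension of `Ptt(n)` is `3n³ - 8n² + 6n`. -/
theorem dim_Ptt (n : ℕ) (hn : 4 ≤ n) (heven : Even n) :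
    adim (Ptt n) = 3 * n ^ 3 - 8 * n ^ 2 + 6 * n := by
  have hadim : adim (Ptt n) = Module.finrank ℝ (vectorSpan ℝ (vertices n)) := by
    rw [adim, Ptt, affineSpan_convexHull, direction_affineSpan]
    rfl
  have hslot : Nonempty (Slot n) := ⟨⟨1, Finset.mem_Icc.2 ⟨le_rfl, by omega⟩⟩⟩
  have h1 := Subspace.finrank_add_finrank_dualAnnihilator_eq (vectorSpan ℝ (vertices n))
  rw [dualAnnihilator_vectorSpan hn heven, finrank_pt, ← hadim,
    ← (Submodule.equivMapOfInjective _ playForm_injective _).finrank_eq] at h1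
  have h2 := finrank_range_coeffMap (V := Team n) (K := Slot n) (by rw [card_team]; omega)
  rw [card_slot, card_team] at h2
  obtain ⟨m, rfl⟩ : ∃ m, n = m + 4 := ⟨n - 4, by omega⟩
  have e1 : 2 * (m + 4) - 2 = 2 * m + 6 := by omega
  have e2 : (m + 4) * (m + 4) - (m + 4) = (m + 4) * (m + 3) := by
    rw [← Nat.mul_sub_one]
    rfl
  have e3 : m + 4 - 1 = m + 3 := rfl
  have e4 : 3 * (m + 4) ^ 3 - 8 * (m + 4) ^ 2 = (3 * m + 4) * (m + 4) ^ 2 := by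
    rw [Nat.sub_eq_iff_eq_add (by nlinarith [Nat.zero_le m])]
    ring
  rw [e1, e2] at h1
  rw [e2, e3] at h2
  rw [e4]
  nlinarith

end TTP
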